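/- arXiv:2307.07455 — 3 statements merged into one kernel-verified Lean document; each statement's English description precedes it below -/
import Mathlib

section
/- Let J be a finite set, c : J → ℝ_{>0}, f : J → R̂ and m ∈ R̂, with f(j) ≠ ∞ for all j ∈ J and m ≠ −∞. Define U = m ⊔ ⨆_{j ∈ J, c(j) < 1} (1/(1−c(j)))·f(j), and let F : R̂ → R̂ be the monotone map F(r) = (⨆_{j ∈ J} (c(j)·r + f(j))) ⊔ m. Then the least r ∈ R̂ with r = F(r), which equals inf{r ∈ R̂ | r ≥ F(r)}, is U if f(j) + (c(j)−1)·U ≤ 0 for every j ∈ J with c(j) ≥ 1 (where (c(j)−1)·U is taken to be 0 when c(j) = 1), and is ∞ otherwise. -/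
namespace RESpaper

noncomputable section

/-- Addition on the extended reals in which `⊤` (i.e. `∞`) dominates. -/
def eadd (x y : EReal) : EReal := if x = ⊤ ∨ y = ⊤ then ⊤ else x + y

/-- The operator `eq-∞`. -/
def eqNegInfVal (x : EReal) : EReal := if x = ⊥ then ⊥ else ⊤

/-- The operator `eq∞`. -/
def eqInfVal (x : EReal) : EReal := if x = ⊤ then ⊤ else ⊥

open Classical in
/-- The sum, with respect to `eadd`, of a finite family of extended reals. -/
def eSum {ι : Type*} (s : Finset ι) (e : ι → EReal) : EReal :=
  if ∃ i ∈ s, e i = ⊤ then ⊤ else ∑ i ∈ s, e i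

/-- Syntax of expressions over a set `V` of variables. -/
inductive Expr (V : Type*) where
  | var : V → Expr V
  | const : EReal → Expr V
  | scale : {c : ℝ // 0 < c} → Expr V → Expr V
  | add : Expr V → Expr V → Expr V
  | emin : Expr V → Expr V → Expr V
  | emax : Expr V → Expr V → Expr V
  | condL : Expr V → Expr V → Expr V → Expr V   -- (e₁ ⇒ e₂ ◇ e₃)
  | condR : Expr V → Expr V → Expr V → Expr V   -- (e₁ → e₂ ◇ e₃)
  | eqm : Expr V → Expr V                       -- eq-∞(e)

variable {V : Type*}

/-- Evaluation of an expression under a valuation `η`. -/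
def Expr.eval (η : V → EReal) : Expr V → EReal
  | var X => η X
  | const d => d
  | scale c e => (c.1 : EReal) * Expr.eval η e
  | add e₁ e₂ => eadd (Expr.eval η e₁) (Expr.eval η e₂)
  | emin e₁ e₂ => Expr.eval η e₁ ⊓ Expr.eval η e₂
  | emax e₁ e₂ => Expr.eval η e₁ ⊔ Expr.eval η e₂
  | condL e₁ e₂ e₃ =>
      if Expr.eval η e₁ ≤ 0 then Expr.eval η e₂ ⊓ Expr.eval η e₃ else Expr.eval η e₃
  | condR e₁ e₂ e₃ =>
      if Expr.eval η e₁ < 0 then Expr.eval η e₂ else Expr.eval η e₂ ⊔ Expr.eval η e₃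
  | eqm e => eqNegInfVal (Expr.eval η e)

/-- The set of variables occurring in an expression. -/
def Expr.occ : Expr V → Set V
  | var X => {X}
  | const _ => ∅
  | scale _ e => Expr.occ e
  | add e₁ e₂ => Expr.occ e₁ ∪ Expr.occ e₂
  | emin e₁ e₂ => Expr.occ e₁ ∪ Expr.occ e₂
  | emax e₁ e₂ => Expr.occ e₁ ∪ Expr.occ e₂
  | condL e₁ e₂ e₃ => Expr.occ e₁ ∪ Expr.occ e₂ ∪ Expr.occ e₃
  | condR e₁ e₂ e₃ => Expr.occ e₁ ∪ Expr.occ e₂ ∪ Expr.occ e₃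
  | eqm e => Expr.occ e

/-- `e` contains no occurrence of the conditional operators. -/
def Expr.noCond : Expr V → Prop
  | var _ => True
  | const _ => True
  | scale _ e => Expr.noCond e
  | add e₁ e₂ => Expr.noCond e₁ ∧ Expr.noCond e₂
  | emin e₁ e₂ => Expr.noCond e₁ ∧ Expr.noCond e₂
  | emax e₁ e₂ => Expr.noCond e₁ ∧ Expr.noCond e₂
  | condL _ _ _ => False
  | condR _ _ _ => False
  | eqm e => Expr.noCond e

/-- Syntactic substitution `e[X := g]`. -/
def Expr.subst [DecidableEq V] (X : V) (g : Expr V) : Expr V → Expr V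
  | var Y => if Y = X then g else var Y
  | const d => const d
  | scale c e => scale c (Expr.subst X g e)
  | add e₁ e₂ => add (Expr.subst X g e₁) (Expr.subst X g e₂)
  | emin e₁ e₂ => emin (Expr.subst X g e₁) (Expr.subst X g e₂)
  | emax e₁ e₂ => emax (Expr.subst X g e₁) (Expr.subst X g e₂)
  | condL e₁ e₂ e₃ => condL (Expr.subst X g e₁) (Expr.subst X g e₂) (Expr.subst X g e₃)
  | condR e₁ e₂ e₃ => condR (Expr.subst X g e₁) (Expr.subst X g e₂) (Expr.subst X g e₃)
  | eqm e => eqm (Expr.subst X g e)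

/-- `(Σ_{(c,X) ∈ cs} c·X) + rest`. -/
def scaledSum (cs : List ({c : ℝ // 0 < c} × V)) (rest : Expr V) : Expr V :=
  cs.foldr (fun p acc => Expr.add (Expr.scale p.1 (Expr.var p.2)) acc) rest

/-- `(Σ_{X ∈ ms} eq-∞(X)) + rest`. -/
def eqmSum (ms : List V) (rest : Expr V) : Expr V :=
  ms.foldr (fun X acc => Expr.add (Expr.eqm (Expr.var X)) acc) rest

/-- A term of the shape `(Σ_{X∈𝒳'} c^X·X) + (Σ_{X∈𝒳''} eq-∞(X)) + d`
with the variables in each of the two sums pairwise distinct. -/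
def IsSimpleTerm (e : Expr V) : Prop :=
  ∃ (cs : List ({c : ℝ // 0 < c} × V)) (ms : List V) (d : EReal),
    (cs.map Prod.snd).Nodup ∧ ms.Nodup ∧ e = scaledSum cs (eqmSum ms (Expr.const d))

/-- Finite disjunction; the empty disjunction is `−∞`. -/
def disjList : List (Expr V) → Expr V
  | [] => Expr.const ⊥
  | [e] => e
  | e :: es => Expr.emax e (disjList es)

/-- Finite conjunction; the empty conjunction is `∞`. -/
def conjList : List (Expr V) → Expr V
  | [] => Expr.const ⊤
  | [e] => e
  | e :: es => Expr.emin e (conjList es)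

/-- Simple conjunctive normal form. -/
def IsSimpleCNF (e : Expr V) : Prop :=
  ∃ ls : List (List (Expr V)),
    (∀ l ∈ ls, ∀ t ∈ l, IsSimpleTerm t) ∧ e = conjList (ls.map disjList)

/-- Simple disjunctive normal form. -/
def IsSimpleDNF (e : Expr V) : Prop :=
  ∃ ls : List (List (Expr V)),
    (∀ l ∈ ls, ∀ t ∈ l, IsSimpleTerm t) ∧ e = disjList (ls.map conjList)

/-- Conjunctive normal form. -/
inductive IsCNF : Expr V → Prop where
  | simple {e : Expr V} : IsSimpleCNF e → IsCNF e
  | condL {e₁ e₂ e₃ : Expr V} :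
      IsSimpleCNF e₁ → IsCNF e₂ → IsCNF e₃ → IsCNF (Expr.condL e₁ e₂ e₃)
  | condR {e₁ e₂ e₃ : Expr V} :
      IsSimpleCNF e₁ → IsCNF e₂ → IsCNF e₃ → IsCNF (Expr.condR e₁ e₂ e₃)

/-- Disjunctive normal form. -/
inductive IsDNF : Expr V → Prop where
  | simple {e : Expr V} : IsSimpleDNF e → IsDNF e
  | condL {e₁ e₂ e₃ : Expr V} :
      IsSimpleDNF e₁ → IsDNF e₂ → IsDNF e₃ → IsDNF (Expr.condL e₁ e₂ e₃)
  | condR {e₁ e₂ e₃ : Expr V} :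
      IsSimpleDNF e₁ → IsDNF e₂ → IsDNF e₃ → IsDNF (Expr.condR e₁ e₂ e₃)

/-- Fixed-point symbols. -/
inductive FP where
  | mu : FP
  | nu : FP

/-- A real equation system: a finite sequence of fixed-point equations `σ X = e`. -/
abbrev RES (V : Type*) := List (FP × V × Expr V)

/-- The bound variables of a RES. -/
def bnd (E : RES V) : List V := E.map (fun p => p.2.1)

variable [DecidableEq V]

/-- The solution `[[ℰ]]η` of a real equation system. -/
def sol : RES V → (V → EReal) → V → EReal
  | [], η => η
  | (FP.mu, X, e) :: E, η =>
      sol E (Function.update η X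
        (sInf {r : EReal | Expr.eval (sol E (Function.update η X r)) e ≤ r}))
  | (FP.nu, X, e) :: E, η =>
      sol E (Function.update η X
        (sSup {r : EReal | r ≤ Expr.eval (sol E (Function.update η X r)) e}))

/-- Equivalence of real equation systems. -/
def REquiv (E E' : RES V) : Prop :=
  ∀ F : RES V, (∀ Y ∈ bnd F, Y ∉ bnd E ∧ Y ∉ bnd E') →
    ∀ η : V → EReal, sol (E ++ F) η = sol (E' ++ F) η


theorem eadd_mono {x x' y y' : EReal} (hx : x ≤ x') (hy : y ≤ y') : eadd x y ≤ eadd x' y' := by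
  unfold eadd
  split_ifs with h h'
  · exact le_rfl
  · rcases h with rfl | rfl <;> simp_all
  · exact le_top
  · exact add_le_add hx hy

theorem eadd_coe_left_le_iff {a b : ℝ} {f : EReal} (hf : f ≠ ⊤) :
    eadd (a : EReal) f ≤ b ↔ f ≤ ((b - a : ℝ) : EReal) := by
  induction f with
  | bot => simp [eadd]
  | top => exact absurd rfl hf
  | coe x =>
    simp only [eadd, EReal.coe_ne_top, or_self, if_false]
    norm_cast
    constructor <;> intro <;> linarith

theorem eadd_comm (x y : EReal) : eadd x y = eadd y x := by
  simp only [eadd, or_comm, add_comm]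

/-- For a contracting slope, being a prefixed point means lying above `f / (1 - c)`. -/
theorem eadd_mul_le_self_iff_of_lt_one {c r : ℝ} {f : EReal} (hf : f ≠ ⊤) (hc : c < 1) :
    eadd ((c : EReal) * r) f ≤ r ↔ ((1 / (1 - c) : ℝ) : EReal) * f ≤ r := by
  have h : 0 < 1 - c := sub_pos.2 hc
  rw [← EReal.coe_mul, eadd_coe_left_le_iff hf]
  induction f with
  | bot => simp [EReal.coe_mul_bot_of_pos (inv_pos.2 h)]
  | top => exact absurd rfl hf
  | coe x =>
    norm_cast
    rw [one_div, inv_mul_le_iff₀ h]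
    ring_nf

theorem eadd_mul_le_self_iff {c r : ℝ} {f : EReal} (hf : f ≠ ⊤) :
    eadd ((c : EReal) * r) f ≤ r ↔
      eadd f (if c = 1 then (0 : EReal) else ((c - 1 : ℝ) : EReal) * r) ≤ 0 := by
  have h : (if c = 1 then (0 : EReal) else ((c - 1 : ℝ) : EReal) * r) =
      (((c - 1) * r : ℝ) : EReal) := by
    split_ifs with h
    · simp [h]
    · norm_cast
  rw [h, eadd_comm f, ← EReal.coe_mul, ← EReal.coe_zero, eadd_coe_left_le_iff hf,
    eadd_coe_left_le_iff hf]
  ring_nf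

open Classical in
/-- explicit description of the least fixed point of
`r ↦ (⨆_{j∈J} (c_j·r + f_j)) ⊔ m`. -/
theorem least_fixed_point_formula {ι : Type*} (J : Finset ι) (c : ι → ℝ)
    (hc : ∀ j ∈ J, 0 < c j) (f : ι → EReal) (m : EReal)
    (hf : ∀ j ∈ J, f j ≠ ⊤) (hm : m ≠ ⊥)
    (U : EReal)
    (hU : U = m ⊔ (J.filter fun j => c j < 1).sup
        (fun j => ((1 / (1 - c j) : ℝ) : EReal) * f j))
    (F : EReal → EReal)
    (hF : F = fun r => (J.sup fun j => eadd (((c j : ℝ) : EReal) * r) (f j)) ⊔ m) :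
    IsLeast {r : EReal | F r = r} (sInf {r : EReal | F r ≤ r}) ∧
    sInf {r : EReal | F r ≤ r} =
      (if ∀ j ∈ J, 1 ≤ c j →
          eadd (f j) (if c j = 1 then (0 : EReal) else ((c j - 1 : ℝ) : EReal) * U) ≤ 0
       then U else ⊤) := by
  have hmono : Monotone F := by
    rw [hF]
    intro a b hab
    refine sup_le_sup_right (Finset.sup_mono_fun fun j hj => eadd_mono ?_ le_rfl) m
    exact mul_le_mul_of_nonneg_left hab (EReal.coe_nonneg.2 (hc j hj).le)
  refine ⟨OrderHom.isLeast_lfp ⟨F, hmono⟩, ?_⟩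
  have hFle (r : EReal) : F r ≤ r ↔ (∀ j ∈ J, eadd ((c j : EReal) * r) (f j) ≤ r) ∧ m ≤ r := by
    simp [hF, Finset.sup_le_iff]
  have hUle (r : EReal) : U ≤ r ↔
      m ≤ r ∧ ∀ j ∈ J, c j < 1 → ((1 / (1 - c j) : ℝ) : EReal) * f j ≤ r := by
    simp [hU, Finset.sup_le_iff]
  have hmU : m ≤ U := ((hUle U).1 le_rfl).1
  have hlow (r : EReal) (hr : F r ≤ r) : U ≤ r := by
    rw [hFle] at hr
    induction r with
    | bot => exact absurd (le_bot_iff.1 hr.2) hm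
    | top => exact le_top
    | coe r =>
      exact (hUle _).2 ⟨hr.2, fun j hj h =>
        (eadd_mul_le_self_iff_of_lt_one (hf j hj) h).1 (hr.1 j hj)⟩
  induction U with
  | bot => exact absurd (le_bot_iff.1 hmU) hm
  | top =>
    rw [ite_self, sInf_eq_top]
    exact fun r hr => top_le_iff.1 (hlow r hr)
  | coe u =>
    split_ifs with h
    · refine le_antisymm (sInf_le ((hFle _).2 ⟨fun j hj => ?_, hmU⟩)) (le_sInf hlow)
      rcases lt_or_ge (c j) 1 with hj1 | hj1
      · exact (eadd_mul_le_self_iff_of_lt_one (hf j hj) hj1).2 (((hUle u).1 le_rfl).2 j hj hj1)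
      · exact (eadd_mul_le_self_iff (hf j hj)).2 (h j hj hj1)
    · push Not at h
      obtain ⟨j, hj, hj1, hlt⟩ := h
      rw [sInf_eq_top]
      intro r hr
      have hur := hlow r hr
      induction r with
      | bot => exact absurd hur (by simp)
      | top => rfl
      | coe r =>
        refine absurd ((eadd_mul_le_self_iff (hf j hj)).1 (((hFle _).1 hr).1 j hj))
          (not_le.2 (hlt.trans_le (eadd_mono le_rfl ?_)))
        split_ifs
        · exact le_rfl
        · exact mul_le_mul_of_nonneg_left hur (EReal.coe_nonneg.2 (sub_nonneg.2 hj1))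

end
end RESpaper
end

section
/- Let J be a finite set, c : J → ℝ_{>0}, f : J → R̂ and m ∈ R̂, with m ≠ ∞. Define U = m ⊓ ⨅_{j ∈ J, c(j) < 1} (1/(1−c(j)))·f(j), and let F : R̂ → R̂ be the monotone map F(r) = (⨅_{j ∈ J} (c(j)·r + f(j))) ⊓ m. Then the greatest r ∈ R̂ with r = F(r), which equals sup{r ∈ R̂ | F(r) ≥ r}, is −∞ if there exists j ∈ J with c(j) ≥ 1 such that f(j) + (c(j)−1)·U < 0 (where (c(j)−1)·U is taken to be 0 when c(j) = 1), and is U otherwise. -/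
namespace RESpaper

noncomputable section

variable {V : Type*}

variable [DecidableEq V]

theorem eadd_mono_left {x y : EReal} (h : x ≤ y) (z : EReal) : eadd x z ≤ eadd y z := by
  unfold eadd
  split_ifs with h₁ h₂ h₂
  · exact le_rfl
  · rcases h₁ with rfl | h₁
    · exact absurd (Or.inl (top_le_iff.mp h)) h₂
    · exact absurd (Or.inr h₁) h₂
  · exact le_top
  · gcongr

theorem eadd_coe (x y : ℝ) : eadd (x : EReal) y = ((x + y : ℝ) : EReal) := by
  simp [eadd]

theorem eadd_top_right (x : EReal) : eadd x ⊤ = ⊤ := by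
  simp [eadd]

theorem eadd_top_left (x : EReal) : eadd ⊤ x = ⊤ := by
  simp [eadd]

theorem eadd_coe_bot (x : ℝ) : eadd (x : EReal) ⊥ = ⊥ := by
  simp [eadd]

theorem eadd_bot_coe (x : ℝ) : eadd ⊥ (x : EReal) = ⊥ := by
  simp [eadd]

theorem coe_le_eadd_iff_of_lt_one {c : ℝ} (hc : c < 1) (r : ℝ) (x : EReal) :
    (r : EReal) ≤ eadd ((c : EReal) * r) x ↔ (r : EReal) ≤ ((1 / (1 - c) : ℝ) : EReal) * x := by
  have h : 0 < 1 - c := sub_pos.mpr hc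
  rw [← EReal.coe_mul]
  induction x with
  | bot => rw [eadd_coe_bot, EReal.coe_mul_bot_of_pos (one_div_pos.mpr h)]
  | top => simp [eadd_top_right, EReal.coe_mul_top_of_pos (one_div_pos.mpr h), -one_div]
  | coe x =>
    rw [eadd_coe, ← EReal.coe_mul, EReal.coe_le_coe_iff, EReal.coe_le_coe_iff, one_div_mul_eq_div,
      le_div_iff₀ h]
    constructor <;> intro <;> linarith

theorem coe_le_eadd_iff_nonneg (c r : ℝ) (x : EReal) :
    (r : EReal) ≤ eadd ((c : EReal) * r) x ↔
      0 ≤ eadd x (if c = 1 then (0 : EReal) else ((c - 1 : ℝ) : EReal) * r) := by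
  have h : (if c = 1 then (0 : EReal) else ((c - 1 : ℝ) : EReal) * r) =
      (((c - 1) * r : ℝ) : EReal) := by
    split_ifs with h
    · simp [h]
    · rw [EReal.coe_mul]
  rw [h, ← EReal.coe_mul]
  induction x with
  | bot => rw [eadd_coe_bot, eadd_bot_coe]; simp
  | top => simp [eadd_top_right, eadd_top_left]
  | coe x =>
    rw [eadd_coe, eadd_coe, EReal.coe_le_coe_iff, EReal.coe_nonneg]
    constructor <;> intro <;> linarith

/-- The increment `x + (c - 1)·r`, with the second summand read as `0` when `c = 1`, is monotone
in `r` for `1 ≤ c`. -/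
theorem eadd_sub_one_mul_mono {c : ℝ} (hc : 1 ≤ c) (x : EReal) {r s : ℝ} (h : r ≤ s) :
    eadd x (if c = 1 then (0 : EReal) else ((c - 1 : ℝ) : EReal) * r) ≤
      eadd x (if c = 1 then (0 : EReal) else ((c - 1 : ℝ) : EReal) * s) := by
  split_ifs
  · exact le_rfl
  · rw [← EReal.coe_mul, ← EReal.coe_mul]
    have hrs : (c - 1) * r ≤ (c - 1) * s := mul_le_mul_of_nonneg_left h (sub_nonneg.mpr hc)
    induction x with
    | bot => rw [eadd_bot_coe, eadd_bot_coe]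
    | top => simp [eadd_top_left]
    | coe x =>
      rw [eadd_coe, eadd_coe, EReal.coe_le_coe_iff]
      linarith

theorem isGreatest_fixedPoints_sSup {α : Type*} [CompleteLattice α] {F : α → α}
    (hF : Monotone F) : IsGreatest {r | F r = r} (sSup {r | r ≤ F r}) :=
  OrderHom.isGreatest_gfp ⟨F, hF⟩

open Classical in
/-- explicit description of the greatest fixed point of
`r ↦ (⨅_{j∈J} (c_j·r + f_j)) ⊓ m`. -/
theorem greatest_fixed_point_formula {ι : Type*} (J : Finset ι) (c : ι → ℝ)
    (hc : ∀ j ∈ J, 0 < c j) (f : ι → EReal) (m : EReal) (hm : m ≠ ⊤)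
    (U : EReal)
    (hU : U = m ⊓ (J.filter fun j => c j < 1).inf
        (fun j => ((1 / (1 - c j) : ℝ) : EReal) * f j))
    (F : EReal → EReal)
    (hF : F = fun r => (J.inf fun j => eadd (((c j : ℝ) : EReal) * r) (f j)) ⊓ m) :
    IsGreatest {r : EReal | F r = r} (sSup {r : EReal | r ≤ F r}) ∧
    sSup {r : EReal | r ≤ F r} =
      (if ∃ j ∈ J, 1 ≤ c j ∧
          eadd (f j) (if c j = 1 then (0 : EReal) else ((c j - 1 : ℝ) : EReal) * U) < 0
       then ⊥ else U) := by
  have hle : ∀ r, r ≤ F r ↔ (∀ j ∈ J, r ≤ eadd ((c j : EReal) * r) (f j)) ∧ r ≤ m := by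
    simp [hF]
  have hleU : ∀ r, r ≤ U ↔
      r ≤ m ∧ ∀ j ∈ J, c j < 1 → r ≤ ((1 / (1 - c j) : ℝ) : EReal) * f j := by
    simp [hU]
  have hUtop : U < ⊤ := (((hleU U).mp le_rfl).1).trans_lt hm.lt_top
  have hmono : Monotone F := by
    intro r s hrs
    simp only [hF]
    refine inf_le_inf_right _ (Finset.inf_mono_fun fun j hj => eadd_mono_left ?_ _)
    exact mul_le_mul_of_nonneg_left hrs (EReal.coe_nonneg.mpr (hc j hj).le)
  have hpost_le : ∀ r, r ≤ F r → r ≤ U := by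
    intro r hr
    obtain ⟨hJ, hrm⟩ := (hle r).mp hr
    induction r with
    | bot => exact bot_le
    | top => exact absurd (top_le_iff.mp hrm) hm
    | coe r =>
      exact (hleU r).mpr ⟨hrm, fun j hj hj1 => (coe_le_eadd_iff_of_lt_one hj1 r _).mp (hJ j hj)⟩
  refine ⟨isGreatest_fixedPoints_sSup hmono, ?_⟩
  split_ifs with hbad
  · obtain ⟨j, hj, hj1, hneg⟩ := hbad
    refine sSup_eq_bot.mpr fun r hr => ?_
    have hrU := hpost_le r hr
    by_contra hrbot
    have hUbot : U ≠ ⊥ := ne_bot_of_le_ne_bot hrbot hrU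
    lift r to ℝ using ⟨(hrU.trans_lt hUtop).ne, hrbot⟩
    lift U to ℝ using ⟨hUtop.ne, hUbot⟩
    have hnonneg := (coe_le_eadd_iff_nonneg _ _ _).mp (((hle r).mp hr).1 j hj)
    exact hneg.not_ge
      (hnonneg.trans (eadd_sub_one_mul_mono hj1 _ (EReal.coe_le_coe_iff.mp hrU)))
  · push Not at hbad
    refine le_antisymm (sSup_le hpost_le) (le_sSup ?_)
    by_cases hUbot : U = ⊥
    · simp [hUbot]
    lift U to ℝ using ⟨hUtop.ne, hUbot⟩
    obtain ⟨hUm, hUJ⟩ := (hleU U).mp le_rfl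
    refine (hle U).mpr ⟨fun j hj => ?_, hUm⟩
    rcases lt_or_ge (c j) 1 with hj1 | hj1
    · exact (coe_le_eadd_iff_of_lt_one hj1 U _).mpr (hUJ j hj hj1)
    · exact (coe_le_eadd_iff_nonneg _ _ _).mpr (by convert hbad j hj hj1)

end
end RESpaper
end

section
/- Let X be a variable and e1, e2, e3 expressions, and let g2, g3 be expressions with X ∉ occ(g2) and X ∉ occ(g3) such that μ X = e2 ≡ μ X = g2 and μ X = e3 ≡ μ X = g3. Then μ X = (e1 ⇒ e2 ◇ e3) ≡ μ X = (e1[X := g2 ∧ g3] ⇒ g2 ◇ g3). -/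
namespace RESpaper

noncomputable section

variable {V : Type*}

variable [DecidableEq V]

theorem eadd_mono_s15 {a b c d : EReal} (h₁ : a ≤ b) (h₂ : c ≤ d) : eadd a c ≤ eadd b d := by
  unfold eadd
  by_cases h : b = ⊤ ∨ d = ⊤
  · simp [h]
  · have h' : ¬(a = ⊤ ∨ c = ⊤) := by
      rintro (rfl | rfl)
      · exact h (Or.inl (top_le_iff.mp h₁))
      · exact h (Or.inr (top_le_iff.mp h₂))
    rw [if_neg h, if_neg h']
    exact add_le_add h₁ h₂

theorem eqNegInfVal_mono : Monotone eqNegInfVal := by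
  intro a b h
  unfold eqNegInfVal
  by_cases hb : b = ⊥
  · have ha : a = ⊥ := le_bot_iff.mp (hb ▸ h)
    simp [ha]
  · simp [hb]

omit [DecidableEq V] in
theorem Expr.eval_mono (e : Expr V) : Monotone fun η : V → EReal => e.eval η := by
  intro η ζ h
  induction e with
  | var X => exact h X
  | const d => exact le_rfl
  | scale c e ih =>
    exact mul_le_mul_of_nonneg_left ih (EReal.coe_nonneg.mpr c.2.le)
  | add e₁ e₂ ih₁ ih₂ => exact eadd_mono_s15 ih₁ ih₂
  | emin e₁ e₂ ih₁ ih₂ => exact inf_le_inf ih₁ ih₂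
  | emax e₁ e₂ ih₁ ih₂ => exact sup_le_sup ih₁ ih₂
  | condL e₁ e₂ e₃ ih₁ ih₂ ih₃ =>
    simp only [Expr.eval] at ih₁ ih₂ ih₃ ⊢
    by_cases hζ : Expr.eval ζ e₁ ≤ 0
    · rw [if_pos (ih₁.trans hζ), if_pos hζ]
      exact inf_le_inf ih₂ ih₃
    · rw [if_neg hζ]
      split_ifs
      · exact inf_le_right.trans ih₃
      · exact ih₃
  | condR e₁ e₂ e₃ ih₁ ih₂ ih₃ =>
    simp only [Expr.eval] at ih₁ ih₂ ih₃ ⊢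
    by_cases hη : Expr.eval η e₁ < 0
    · rw [if_pos hη]
      split_ifs
      · exact ih₂
      · exact ih₂.trans le_sup_left
    · rw [if_neg hη, if_neg fun hζ => hη (ih₁.trans_lt hζ)]
      exact sup_le_sup ih₂ ih₃
  | eqm e ih => exact eqNegInfVal_mono ih

omit [DecidableEq V] in
theorem Expr.eval_congr {e : Expr V} {η ζ : V → EReal} (h : ∀ Y ∈ e.occ, η Y = ζ Y) :
    e.eval η = e.eval ζ := by
  induction e <;> simp_all [Expr.eval, Expr.occ]

theorem Expr.eval_update_of_notMem_occ {X : V} {e : Expr V} (h : X ∉ e.occ) (η : V → EReal)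
    (r : EReal) : e.eval (Function.update η X r) = e.eval η :=
  Expr.eval_congr fun _ hY => Function.update_of_ne (ne_of_mem_of_not_mem hY h) _ _

theorem Expr.eval_subst (X : V) (g e : Expr V) (η : V → EReal) :
    (Expr.subst X g e).eval η = e.eval (Function.update η X (g.eval η)) := by
  induction e with
  | var Y =>
    by_cases h : Y = X
    · subst h
      simp [Expr.subst, Expr.eval]
    · simp [Expr.subst, Expr.eval, h]
  | _ => simp_all [Expr.subst, Expr.eval]

theorem sol_mono (E : RES V) : Monotone (sol E) := by
  induction E with
  | nil => exact monotone_id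
  | cons p E ih =>
    obtain ⟨σ, X, e⟩ := p
    intro η ζ h
    have hup {r s : EReal} (hrs : r ≤ s) : Function.update η X r ≤ Function.update ζ X s :=
      update_le_update_iff.mpr ⟨hrs, fun Y _ => h Y⟩
    have he (r : EReal) : e.eval (sol E (Function.update η X r)) ≤
        e.eval (sol E (Function.update ζ X r)) :=
      e.eval_mono (ih (hup le_rfl))
    cases σ with
    | mu => exact ih (hup (sInf_le_sInf fun r hr => (he r).trans hr))
    | nu => exact ih (hup (sSup_le_sSup fun r hr => le_trans hr (he r)))

theorem sol_apply_of_notMem_bnd {X : V} {E : RES V} (h : X ∉ bnd E) (η : V → EReal) :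
    sol E η X = η X := by
  induction E generalizing η with
  | nil => rfl
  | cons p E ih =>
    obtain ⟨σ, Y, e⟩ := p
    simp only [bnd, List.map_cons, List.mem_cons, not_or] at h
    cases σ <;> exact (ih h.2 _).trans (Function.update_of_ne h.1 _ _)

/-- The least solution of `X = e` with the remaining variables fixed by `η`. -/
def muVal (X : V) (e : Expr V) (η : V → EReal) : EReal :=
  sInf {r : EReal | e.eval (Function.update η X r) ≤ r}

theorem muVal_le {X : V} {e : Expr V} {η : V → EReal} {r : EReal}
    (h : e.eval (Function.update η X r) ≤ r) : muVal X e η ≤ r :=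
  sInf_le h

theorem eval_update_muVal_le (X : V) (e : Expr V) (η : V → EReal) :
    e.eval (Function.update η X (muVal X e η)) ≤ muVal X e η :=
  le_sInf fun _ hr => le_trans
    (e.eval_mono (update_le_update_iff'.mpr (muVal_le hr))) hr

theorem muVal_of_notMem_occ {X : V} {e : Expr V} (h : X ∉ e.occ) (η : V → EReal) :
    muVal X e η = e.eval η := by
  simp only [muVal, Expr.eval_update_of_notMem_occ h]
  exact csInf_Ici

theorem REquiv.muVal_eq {X : V} {e e' : Expr V} (h : REquiv [(FP.mu, X, e)] [(FP.mu, X, e')])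
    (η : V → EReal) : muVal X e η = muVal X e' η := by
  simpa [sol, muVal] using congrFun (h [] (by simp [bnd]) η) X

theorem sInf_eval_sol_le_of_muVal_le {X : V} {e e' : Expr V}
    (h : ∀ η, muVal X e η ≤ muVal X e' η) {F : RES V} (hF : X ∉ bnd F) (η : V → EReal) :
    sInf {r : EReal | e.eval (sol F (Function.update η X r)) ≤ r} ≤
      sInf {r : EReal | e'.eval (sol F (Function.update η X r)) ≤ r} := by
  refine le_sInf fun r hr => ?_
  have hX (t : EReal) : sol F (Function.update η X t) X = t := by
    rw [sol_apply_of_notMem_bnd hF, Function.update_self]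
  set ζ := sol F (Function.update η X r) with hζ
  have hle : muVal X e ζ ≤ r := by
    refine (h ζ).trans (muVal_le ?_)
    have hup : Function.update ζ X r = ζ := by
      rw [Function.update_eq_self_iff]
      exact (hX r).symm
    rw [hup]
    exact hr
  have hsol : sol F (Function.update η X (muVal X e ζ)) ≤
      Function.update ζ X (muVal X e ζ) := by
    refine le_update_iff.mpr ⟨(hX _).le, fun Y _ => ?_⟩
    exact sol_mono F (update_le_update_iff'.mpr hle) Y
  have hmem : e.eval (sol F (Function.update η X (muVal X e ζ))) ≤ muVal X e ζ :=
    (e.eval_mono hsol).trans (eval_update_muVal_le X e ζ)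
  exact le_trans (sInf_le (Set.mem_ofPred.mpr hmem)) hle

/-- Two least fixed-point equations for the same variable are equivalent as soon as they have the
same solution in the absence of further equations. -/
theorem REquiv.of_muVal_eq {X : V} {e e' : Expr V} (h : ∀ η, muVal X e η = muVal X e' η) :
    REquiv [(FP.mu, X, e)] [(FP.mu, X, e')] := by
  intro F hF η
  have hX : X ∉ bnd F := fun hX => (hF X hX).1 (by simp [bnd])
  have heq := (sInf_eval_sol_le_of_muVal_le (fun η => (h η).le) hX η).antisymm
    (sInf_eval_sol_le_of_muVal_le (fun η => (h η).ge) hX η)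
  simp only [List.cons_append, List.nil_append, sol, heq]

theorem muVal_condL (X : V) (e₁ e₂ e₃ : Expr V) (η : V → EReal) :
    muVal X (Expr.condL e₁ e₂ e₃) η =
      if e₁.eval (Function.update η X (muVal X e₂ η ⊓ muVal X e₃ η)) ≤ 0 then
        muVal X e₂ η ⊓ muVal X e₃ η else muVal X e₃ η := by
  have h₂ := eval_update_muVal_le X e₂ η
  have h₃ := eval_update_muVal_le X e₃ η
  have hlow (r : EReal) (hr : (Expr.condL e₁ e₂ e₃).eval (Function.update η X r) ≤ r) :
      muVal X e₂ η ⊓ muVal X e₃ η ≤ r := by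
    simp only [Expr.eval] at hr
    split_ifs at hr
    · exact (inf_le_iff.mp hr).elim (fun h => inf_le_left.trans (muVal_le h))
        fun h => inf_le_right.trans (muVal_le h)
    · exact inf_le_right.trans (muVal_le hr)
  split_ifs with h
  · refine le_antisymm (muVal_le ?_) (le_sInf hlow)
    simp only [Expr.eval]
    rw [if_pos h]
    rcases le_total (muVal X e₂ η) (muVal X e₃ η) with hle | hle
    · rw [inf_eq_left.mpr hle]
      exact inf_le_left.trans h₂
    · rw [inf_eq_right.mpr hle]
      exact inf_le_right.trans h₃
  · have hpos {r : EReal} (hr : muVal X e₂ η ⊓ muVal X e₃ η ≤ r) :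
        ¬e₁.eval (Function.update η X r) ≤ 0 := fun hr' =>
      h ((e₁.eval_mono (update_le_update_iff'.mpr hr)).trans hr')
    refine le_antisymm (muVal_le ?_) (le_sInf fun r hr => muVal_le ?_)
    · simp only [Expr.eval]
      rwa [if_neg (hpos inf_le_right)]
    · have hr' : (Expr.condL e₁ e₂ e₃).eval (Function.update η X r) ≤ r := hr
      simp only [Expr.eval] at hr'
      rwa [if_neg (hpos (hlow r hr))] at hr'

/-- solving `μ X = (e₁ ⇒ e₂ ◇ e₃)`. -/
theorem sol_condL_mu (X : V) (e₁ e₂ e₃ g₂ g₃ : Expr V)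
    (hg₂ : X ∉ g₂.occ) (hg₃ : X ∉ g₃.occ)
    (h2 : REquiv [(FP.mu, X, e₂)] [(FP.mu, X, g₂)])
    (h3 : REquiv [(FP.mu, X, e₃)] [(FP.mu, X, g₃)]) :
    REquiv [(FP.mu, X, Expr.condL e₁ e₂ e₃)]
      [(FP.mu, X, Expr.condL (Expr.subst X (Expr.emin g₂ g₃) e₁) g₂ g₃)] := by
  refine REquiv.of_muVal_eq fun η => ?_
  have hg (r : EReal) : (Expr.emin g₂ g₃).eval (Function.update η X r) = g₂.eval η ⊓ g₃.eval η := by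
    simp only [Expr.eval, Expr.eval_update_of_notMem_occ hg₂, Expr.eval_update_of_notMem_occ hg₃]
  simp only [muVal_condL, h2.muVal_eq, h3.muVal_eq, muVal_of_notMem_occ hg₂,
    muVal_of_notMem_occ hg₃, Expr.eval_subst, hg, Function.update_idem]

end
end RESpaper
end
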